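/- Let p be a prime, n ≥ 1, F a finite field with q = p^n elements, r ∈ F a nonzero element, and b = r^{p−1}. For every polynomial f ∈ F[x] with deg f ≤ q − 2 and f(0) = 0, one has φ_r(f) = f if and only if f lies in the F-linear span of the set {x^{p^k} : 0 ≤ k ≤ n−1} ∪ {(x^p − b·x)^i : 2 ≤ i ≤ p^{n−1} − 1 and i is not a power of p}. -/

import Mathlib

open Polynomial

/-- The map `φ_r : f(x) ↦ f(x+r) − f(r)` on polynomials over a commutative ring. -/
noncomputable def phiMap {R : Type*} [CommRing R] (r : R) (f : R[X]) : R[X] :=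
  f.comp (X + C r) - C (f.eval r)

theorem phiMap_eq_self_iff {R : Type*} [CommRing R] (r : R) (f : R[X]) :
    phiMap r f = f ↔ f.comp (X + C r) = f + C (f.eval r) := by
  rw [phiMap, sub_eq_iff_eq_add]

theorem phiMap_add {R : Type*} [CommRing R] (r : R) (f g : R[X]) :
    phiMap r (f + g) = phiMap r f + phiMap r g := by
  simp only [phiMap, add_comp, eval_add, C_add]
  ring

theorem phiMap_smul {R : Type*} [CommRing R] (r a : R) (f : R[X]) :
    phiMap r (a • f) = a • phiMap r f := by
  simp only [phiMap, smul_eq_C_mul, mul_comp, C_comp, eval_mul, eval_C, C_mul]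
  ring

theorem phiMap_X_pow_char_pow {R : Type*} [CommRing R] (p : ℕ) [Fact p.Prime] [CharP R p]
    (r : R) (k : ℕ) : phiMap r (X ^ p ^ k : R[X]) = X ^ p ^ k := by
  simp [phiMap, add_pow_char_pow]

/-- The polynomial `x^p − r^(p−1) x` is invariant under translation by `r`. -/
theorem X_pow_sub_mul_X_comp_X_add_C {R : Type*} [CommRing R] (p : ℕ) [Fact p.Prime] [CharP R p]
    (r : R) : (X ^ p - C (r ^ (p - 1)) * X : R[X]).comp (X + C r) =
      X ^ p - C (r ^ (p - 1)) * X := by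
  have h : (C r : R[X]) ^ p = C (r ^ (p - 1)) * C r := by
    rw [C_pow, pow_sub_one_mul (Fact.out : p.Prime).ne_zero]
  simp only [sub_comp, mul_comp, X_comp, C_comp, pow_comp, add_pow_char, h]
  ring

theorem monic_X_pow_sub_C_mul_X {R : Type*} [CommRing R] [Nontrivial R] {p : ℕ} (hp : 2 ≤ p)
    (b : R) : (X ^ p - C b * X : R[X]).Monic := by
  refine monic_X_pow_sub ((degree_C_mul_X_le b).trans_lt ?_)
  exact_mod_cast hp

theorem natDegree_X_pow_sub_C_mul_X {R : Type*} [CommRing R] [Nontrivial R] {p : ℕ} (hp : 2 ≤ p)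
    (b : R) : (X ^ p - C b * X : R[X]).natDegree = p := by
  rw [natDegree_sub_eq_left_of_natDegree_lt, natDegree_X_pow]
  rw [natDegree_X_pow]
  exact ((natDegree_C_mul_le b X).trans natDegree_X_le).trans_lt hp

/-- A polynomial of degree less than `p` that is invariant under a nonzero translation in
characteristic `p` is constant. -/
theorem eq_C_of_comp_X_add_C_eq_of_natDegree_lt {F : Type*} [Field F] (p : ℕ) [Fact p.Prime]
    [CharP F p] {r : F} (hr : r ≠ 0) {s : F[X]} (hs : s.comp (X + C r) = s)
    (hdeg : s.natDegree < p) : s = C (s.eval 0) := by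
  have heval (k : ℕ) : s.eval (k * r) = s.eval 0 := by
    induction k with
    | zero => simp
    | succ k ih =>
      rw [← ih, Nat.cast_succ, add_one_mul]
      conv_rhs => rw [← hs]
      simp [eval_comp]
  rw [← sub_eq_zero]
  refine eq_zero_of_natDegree_lt_card_of_eval_eq_zero (ι := Fin p) _
    (f := fun i => ((i : ℕ) : F) * r) ?_ ?_ ?_
  · intro i j hij
    exact Fin.ext (CharP.natCast_injOn_Iio F p i.2 j.2 (mul_right_cancel₀ hr hij))
  · intro i
    simp [heval]
  · simpa using hdeg

/-- Polynomials invariant under translation by `r ≠ 0` in characteristic `p` are polynomials in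
`x^p − r^(p−1) x`. -/
theorem exists_eq_comp_of_comp_X_add_C_eq {F : Type*} [Field F] (p : ℕ) [hp : Fact p.Prime]
    [CharP F p] {r : F} (hr : r ≠ 0) (f : F[X]) (hf : f.comp (X + C r) = f) :
    ∃ g : F[X], f = g.comp (X ^ p - C (r ^ (p - 1)) * X) := by
  set h : F[X] := X ^ p - C (r ^ (p - 1)) * X with hh
  have hmon : h.Monic := monic_X_pow_sub_C_mul_X hp.out.two_le _
  have hnat : h.natDegree = p := natDegree_X_pow_sub_C_mul_X hp.out.two_le _
  have hinv : h.comp (X + C r) = h := X_pow_sub_mul_X_comp_X_add_C p r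
  have h1 : h ≠ 1 := fun e => hp.out.ne_zero (by rw [← hnat, e, natDegree_one])
  induction hd : f.natDegree using Nat.strong_induction_on generalizing f with
  | _ d ih =>
    subst hd
    have hlt : (f %ₘ h).natDegree < p := hnat ▸ natDegree_modByMonic_lt f hmon h1
    have hdiv := modByMonic_add_div f h
    obtain ⟨hq, hs⟩ := div_modByMonic_unique (f := f) ((f /ₘ h).comp (X + C r))
      ((f %ₘ h).comp (X + C r)) hmon ⟨by
        conv_rhs => rw [← hf, ← hdiv]
        rw [add_comp, mul_comp, hinv], by
        refine degree_lt_degree ?_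
        rwa [natDegree_comp, natDegree_X_add_C, mul_one, hnat]⟩
    have hsC := eq_C_of_comp_X_add_C_eq_of_natDegree_lt p hr hs.symm hlt
    rcases lt_or_ge f.natDegree p with hfp | hfp
    · exact ⟨C (f.eval 0), by
        rw [C_comp]
        exact eq_C_of_comp_X_add_C_eq_of_natDegree_lt p hr hf hfp⟩
    · obtain ⟨g, hg⟩ := ih _ (by
        rw [natDegree_divByMonic f hmon, hnat]
        have := hp.out.pos
        omega) (f /ₘ h) hq.symm rfl
      refine ⟨C ((f %ₘ h).eval 0) + X * g, ?_⟩
      rw [add_comp, C_comp, mul_comp, X_comp, ← hg, ← hsC, hdiv]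

/-- over `F = 𝔽_{p^n}`, for nonzero `r` and `b = r^(p−1)`, a
polynomial `f` with `deg f ≤ q − 2` and `f(0) = 0` satisfies `φ_r(f) = f` iff it
lies in the span of the monomials `x^(p^k)` (`0 ≤ k ≤ n−1`) and the polynomials
`(x^p − b·x)^i` (`2 ≤ i ≤ p^(n−1) − 1`, `i` not a power of `p`). -/
theorem phi_r_eigenspace_span {F : Type*} [Field F] [Fintype F] (p n : ℕ)
    (hp : p.Prime) (hn : 1 ≤ n) (hcard : Fintype.card F = p ^ n)
    (r : F) (hr : r ≠ 0) (b : F) (hb : b = r ^ (p - 1))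
    (f : F[X]) (hdeg : f.natDegree ≤ p ^ n - 2) (hf0 : f.eval 0 = 0) :
    phiMap r f = f ↔
      f ∈ Submodule.span F
        ({g : F[X] | ∃ k ≤ n - 1, g = X ^ p ^ k} ∪
         {g : F[X] | ∃ i : ℕ, 2 ≤ i ∧ i ≤ p ^ (n - 1) - 1 ∧
            (¬ ∃ j : ℕ, i = p ^ j) ∧ g = (X ^ p - C b * X) ^ i}) := by
  have : Fact p.Prime := ⟨hp⟩
  have : CharP F p := charP_of_card_eq_prime_pow hcard
  subst hb
  have hinv := X_pow_sub_mul_X_comp_X_add_C p r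
  have hevr : (X ^ p - C (r ^ (p - 1)) * X : F[X]).eval r = 0 := by
    simp [pow_sub_one_mul hp.ne_zero]
  constructor
  · intro hf
    rw [phiMap_eq_self_iff] at hf
    set c : F := f.eval r / r with hc
    obtain ⟨g, hg⟩ := exists_eq_comp_of_comp_X_add_C_eq p hr (f - C c * X) (by
      have : (C (f.eval r) : F[X]) = C c * C r := by rw [← C_mul, hc, div_mul_cancel₀ _ hr]
      rw [sub_comp, hf, this, mul_comp, C_comp, X_comp]
      ring)
    have hg0 : g.coeff 0 = 0 := by
      have := congrArg (eval 0) hg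
      simpa [hf0, eval_comp, hp.ne_zero, coeff_zero_eq_eval_zero, eq_comm] using this
    set S := Submodule.span F
        ({g : F[X] | ∃ k ≤ n - 1, g = X ^ p ^ k} ∪
         {g : F[X] | ∃ i : ℕ, 2 ≤ i ∧ i ≤ p ^ (n - 1) - 1 ∧
            (¬ ∃ j : ℕ, i = p ^ j) ∧ g = (X ^ p - C (r ^ (p - 1)) * X) ^ i})
    have hC (a : F) {g : F[X]} (hg : g ∈ S) : C a * g ∈ S := by
      rw [← smul_eq_C_mul]
      exact S.smul_mem a hg
    have hX (k : ℕ) (hk : k ≤ n - 1) : (X ^ p ^ k : F[X]) ∈ S :=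
      Submodule.subset_span (Or.inl ⟨k, hk, rfl⟩)
    have hpow : p ^ n = p ^ (n - 1) * p := by rw [← pow_succ, Nat.sub_add_cancel hn]
    rw [← sub_add_cancel f (C c * X)]
    refine add_mem ?_ (hC c ?_)
    swap
    · have h0 := hX 0 (Nat.zero_le _)
      rwa [pow_zero, pow_one] at h0
    rw [hg, comp_eq_sum_left, sum_def]
    refine Submodule.sum_mem _ fun i hi => ?_
    have hi0 : i ≠ 0 := by
      rintro rfl
      exact (mem_support_iff.mp hi) hg0
    have hile : i < p ^ (n - 1) := by
      have hle := le_natDegree_of_mem_supp i hi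
      have hdg : g.natDegree * p ≤ max (p ^ n - 2) 1 := by
        have h2 := congrArg natDegree hg
        rw [natDegree_comp, natDegree_X_pow_sub_C_mul_X hp.two_le] at h2
        rw [← h2]
        exact (natDegree_sub_le _ _).trans (max_le_max hdeg ((natDegree_C_mul_le c X).trans natDegree_X_le))
      have hone : 1 < p ^ n := Nat.one_lt_pow (by omega) hp.one_lt
      have hlt : g.natDegree * p < p ^ (n - 1) * p := by omega
      exact hle.trans_lt (Nat.lt_of_mul_lt_mul_right hlt)
    refine hC _ ?_
    by_cases hj : ∃ j : ℕ, i = p ^ j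
    · obtain ⟨j, rfl⟩ := hj
      have hjn : j < n - 1 := (Nat.pow_lt_pow_iff_right hp.one_lt).mp hile
      rw [sub_pow_char_pow, mul_pow, ← pow_mul, ← pow_succ', ← C_pow]
      exact sub_mem (hX _ hjn) (hC _ (hX _ hjn.le))
    · have hi1 : i ≠ 1 := fun e => hj ⟨0, by simpa using e⟩
      exact Submodule.subset_span (Or.inr ⟨i, by omega, by omega, hj, rfl⟩)
  · intro hf
    clear hdeg hf0
    induction hf using Submodule.span_induction with
    | mem x hx =>
      rcases hx with ⟨k, -, rfl⟩ | ⟨i, hi, -, -, rfl⟩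
      · exact phiMap_X_pow_char_pow p r k
      · rw [phiMap, pow_comp, hinv, eval_pow, hevr, zero_pow (by omega), C_0, sub_zero]
    | zero => simp [phiMap]
    | add x y _ _ hx hy => rw [phiMap_add, hx, hy]
    | smul a x _ hx => rw [phiMap_smul, hx]
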